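/- arXiv:2503.00273 — 3 statements merged into one kernel-verified Lean document; each statement's English description precedes it below -/
import Mathlib

section
/- For every ε ∈ (0,1) there exist constants c > 0 and C > 0 such that for all integers n ≥ 2, all Δ ∈ (0, 1-ε], and all horizons t ∈ ℕ with 1 ≤ t ≤ n·(log n)/Δ²: (i) c·tΔ²/(n·log(1 + tΔ²)) ≤ p*_{t,NI} ≤ C·tΔ²/(n·log(1 + tΔ²)), and (ii) c·tΔ²/n ≤ I*_{t,NI} ≤ C·tΔ²/n, where p*_{t,NI} and I*_{t,NI} are the optimal success probability and optimal mutual information over non-interactive algorithms. -/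
open scoped BigOperators

noncomputable section

/-- Probability that pulling arm `a` yields reward `r : Bool` (with `true` = reward 1),
when the best arm is `astar`: `Bernoulli ((1+Δ)/2)` if `a = astar`, else `Bernoulli ((1-Δ)/2)`. -/
def rewP (n : ℕ) (Δ : ℝ) (astar a : Fin n) (r : Bool) : ℝ :=
  if r then (if a = astar then (1 + Δ) / 2 else (1 - Δ) / 2)
  else 1 - (if a = astar then (1 + Δ) / 2 else (1 - Δ) / 2)

/-- Probability of observing the reward sequence `rs` when pulling the arm sequence `as`,
conditionally on the best arm `astar`. -/
def rewSeqP (n t : ℕ) (Δ : ℝ) (astar : Fin n) (as : Fin t → Fin n) (rs : Fin t → Bool) : ℝ :=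
  ∏ s : Fin t, rewP n Δ astar (as s) (rs s)

/-- A valid (possibly jointly random) non-interactive choice of the pull sequence:
a probability distribution over sequences of `t` arms, independent of `a*` and the rewards. -/
def IsNIPulls (n t : ℕ) (ν : (Fin t → Fin n) → ℝ) : Prop :=
  (∀ as, 0 ≤ ν as) ∧ (∑ as : Fin t → Fin n, ν as) = 1

/-- A valid randomized output rule for a non-interactive algorithm. -/
def IsNIOut (n t : ℕ) (out : (Fin t → Fin n) → (Fin t → Bool) → Fin n → ℝ) : Prop :=
  ∀ as rs, (∀ a, 0 ≤ out as rs a) ∧ (∑ a : Fin n, out as rs a) = 1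

/-- Success probability `P(a_{t+1} = a*)` of a non-interactive algorithm `(ν, out)`. -/
def niSuccProb (n t : ℕ) (ν : (Fin t → Fin n) → ℝ)
    (out : (Fin t → Fin n) → (Fin t → Bool) → Fin n → ℝ) (Δ : ℝ) : ℝ :=
  ((n : ℝ))⁻¹ * ∑ astar : Fin n, ∑ as : Fin t → Fin n, ∑ rs : Fin t → Bool,
    ν as * rewSeqP n t Δ astar as rs * out as rs astar

/-- Mutual information (in nats) `I(a*; H_t)` accumulated by a non-interactive algorithm with
pull distribution `ν`, where `H_t = (a_1, r_1, …, a_t, r_t)`. -/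
def niMutualInfo (n t : ℕ) (ν : (Fin t → Fin n) → ℝ) (Δ : ℝ) : ℝ :=
  ∑ astar : Fin n, ∑ as : Fin t → Fin n, ∑ rs : Fin t → Bool,
    ((n : ℝ))⁻¹ * (ν as * rewSeqP n t Δ astar as rs) *
      Real.log ((ν as * rewSeqP n t Δ astar as rs) /
        (((n : ℝ))⁻¹ * ∑ b : Fin n, ν as * rewSeqP n t Δ b as rs))

/-- Optimal success probability over non-interactive algorithms. -/
def pStarNI (n t : ℕ) (Δ : ℝ) : ℝ :=
  sSup {x : ℝ | ∃ ν out, IsNIPulls n t ν ∧ IsNIOut n t out ∧ x = niSuccProb n t ν out Δ}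

/-- Optimal mutual information over non-interactive algorithms. -/
def IStarNI (n t : ℕ) (Δ : ℝ) : ℝ :=
  sSup {x : ℝ | ∃ ν, IsNIPulls n t ν ∧ x = niMutualInfo n t ν Δ}

section ProductSums

variable {ι β : Type*} [Fintype ι] [DecidableEq ι] [Fintype β]

lemma sum_prod_mul_prod (p f : ι → β → ℝ) :
    ∑ x : ι → β, (∏ s, p s (x s)) * ∏ s, f s (x s) = ∏ s, ∑ r, p s r * f s r := by
  simp_rw [Finset.prod_univ_sum, Fintype.piFinset_univ, Finset.prod_mul_distrib]

lemma sum_prod_eq_one {p : ι → β → ℝ} (hp : ∀ s, ∑ r, p s r = 1) :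
    ∑ x : ι → β, ∏ s, p s (x s) = 1 := by
  simpa [hp] using sum_prod_mul_prod p (fun _ _ => 1)

lemma sum_prod_mul_apply {p : ι → β → ℝ} (hp : ∀ s, ∑ r, p s r = 1) (i : ι) (g : β → ℝ) :
    ∑ x : ι → β, (∏ s, p s (x s)) * g (x i) = ∑ r, p i r * g r := by
  have h := sum_prod_mul_prod p (fun s r => if s = i then g r else 1)
  simp only [Finset.prod_ite_eq', Finset.mem_univ, if_true] at h
  rw [h, Finset.prod_eq_single i]
  · simp
  · intro s _ hs
    simp [hs, hp]
  · simp

lemma sum_prod_mul_apply_mul_apply {p : ι → β → ℝ} (hp : ∀ s, ∑ r, p s r = 1) {i j : ι}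
    (hij : i ≠ j) (g h : β → ℝ) :
    ∑ x : ι → β, (∏ s, p s (x s)) * (g (x i) * h (x j)) =
      (∑ r, p i r * g r) * ∑ r, p j r * h r := by
  have H := sum_prod_mul_prod p
    (fun s r => (if s = i then g r else 1) * (if s = j then h r else 1))
  simp only [Finset.prod_mul_distrib, Finset.prod_ite_eq', Finset.mem_univ, if_true] at H
  rw [H, ← Finset.prod_subset (Finset.subset_univ {i, j})]
  · rw [Finset.prod_pair hij]
    simp [hij, hij.symm]
  · intro s _ hs
    simp only [Finset.mem_insert, Finset.mem_singleton, not_or] at hs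
    simp [hs.1, hs.2, hp]

lemma sum_prod_mul_sum {p : ι → β → ℝ} (hp : ∀ s, ∑ r, p s r = 1) (f : ι → β → ℝ) :
    ∑ x : ι → β, (∏ s, p s (x s)) * ∑ s, f s (x s) = ∑ s, ∑ r, p s r * f s r := by
  simp_rw [Finset.mul_sum]
  rw [Finset.sum_comm]
  exact Finset.sum_congr rfl fun i _ => sum_prod_mul_apply hp i (f i)

/-- The second moment of a sum of independent variables is at most the sum of the second
moments plus the square of the mean. -/
lemma sum_prod_mul_sq_sum_le {p : ι → β → ℝ} (hp : ∀ s, ∑ r, p s r = 1) (f : ι → β → ℝ) :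
    ∑ x : ι → β, (∏ s, p s (x s)) * (∑ s, f s (x s)) ^ 2 ≤
      ∑ s, ∑ r, p s r * f s r ^ 2 + (∑ s, ∑ r, p s r * f s r) ^ 2 := by
  have hpair : ∀ i j, ∑ x : ι → β, (∏ s, p s (x s)) * (f i (x i) * f j (x j)) ≤
      (if i = j then ∑ r, p i r * f i r ^ 2 else 0) +
        (∑ r, p i r * f i r) * ∑ r, p j r * f j r := by
    intro i j
    split_ifs with hij
    · subst hij
      rw [sum_prod_mul_apply hp i (fun r => f i r * f i r)]
      simp only [sq]
      exact le_add_of_nonneg_right (mul_self_nonneg _)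
    · rw [sum_prod_mul_apply_mul_apply hp hij, zero_add]
  simp_rw [sq (∑ s, f s _), Finset.sum_mul_sum, Finset.mul_sum]
  rw [Finset.sum_comm]
  calc _ = ∑ i, ∑ j, ∑ x : ι → β, (∏ s, p s (x s)) * (f i (x i) * f j (x j)) :=
        Finset.sum_congr rfl fun i _ => Finset.sum_comm
    _ ≤ ∑ i, ∑ j, ((if i = j then ∑ r, p i r * f i r ^ 2 else 0) +
        (∑ r, p i r * f i r) * ∑ r, p j r * f j r) :=
        Finset.sum_le_sum fun i _ => Finset.sum_le_sum fun j _ => hpair i j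
    _ = _ := by
        simp_rw [Finset.sum_add_distrib, sq (∑ s, ∑ r, p s r * f s r), Finset.sum_mul_sum]
        simp

end ProductSums

section Rewards

variable {n t : ℕ} {Δ : ℝ}

/-- The sign `±1` of a reward. -/
def rewSign (r : Bool) : ℝ := if r then 1 else -1

/-- The reward law of a suboptimal arm. -/
def nullP (Δ : ℝ) (r : Bool) : ℝ := (1 - rewSign r * Δ) / 2

/-- The number of pulls of the arm `a`. -/
def pulls (as : Fin t → Fin n) (a : Fin n) : ℕ := (Finset.univ.filter fun s => as s = a).card

lemma sum_pulls (as : Fin t → Fin n) : ∑ a, pulls as a = t := by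
  simpa [pulls] using (Finset.card_eq_sum_card_fiberwise (f := as) (s := Finset.univ)
    (t := Finset.univ) (fun _ _ => Finset.mem_coe.2 (Finset.mem_univ _))).symm

lemma sum_ite_pulls (as : Fin t → Fin n) (a : Fin n) (c : ℝ) :
    ∑ s, (if as s = a then c else 0) = pulls as a * c := by
  rw [Finset.sum_ite]
  simp [pulls]

lemma prod_ite_pulls (as : Fin t → Fin n) (a : Fin n) (c : ℝ) :
    ∏ s, (if as s = a then c else 1) = c ^ pulls as a := by
  rw [Finset.prod_ite]
  simp [pulls]

lemma sum_rewP (a b : Fin n) : ∑ r, rewP n Δ a b r = 1 := by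
  simp [rewP]

lemma sum_nullP : ∑ r, nullP Δ r = 1 := by
  simp [nullP, rewSign]
  ring

lemma rewP_pos (h0 : 0 < Δ) (h1 : Δ < 1) (a b : Fin n) (r : Bool) : 0 < rewP n Δ a b r := by
  unfold rewP
  split_ifs <;> linarith

lemma nullP_pos (h0 : 0 < Δ) (h1 : Δ < 1) (r : Bool) : 0 < nullP Δ r := by
  cases r <;> simp [nullP, rewSign] <;> linarith

lemma rewSeqP_pos (h0 : 0 < Δ) (h1 : Δ < 1) (a : Fin n) (as : Fin t → Fin n)
    (rs : Fin t → Bool) : 0 < rewSeqP n t Δ a as rs :=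
  Finset.prod_pos fun _ _ => rewP_pos h0 h1 _ _ _

lemma sum_rewSeqP (a : Fin n) (as : Fin t → Fin n) : ∑ rs, rewSeqP n t Δ a as rs = 1 :=
  sum_prod_eq_one fun _ => sum_rewP _ _

/-- The logarithm `log ((1+Δ)/(1-Δ))` of the likelihood ratio of a single success. -/
def logOdds (Δ : ℝ) : ℝ := Real.log ((1 + Δ) / (1 - Δ))

lemma logOdds_pos (h0 : 0 < Δ) (h1 : Δ < 1) : 0 < logOdds Δ :=
  Real.log_pos (by rw [lt_div_iff₀] <;> linarith)

lemma logOdds_le {ε : ℝ} (hε : 0 < ε) (h0 : 0 < Δ) (h1 : Δ ≤ 1 - ε) :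
    logOdds Δ ≤ 2 * Δ / ε := by
  have h : (0 : ℝ) < 1 - Δ := by linarith
  calc logOdds Δ ≤ (1 + Δ) / (1 - Δ) - 1 := Real.log_le_sub_one_of_pos (by positivity)
    _ = 2 * Δ / (1 - Δ) := by field_simp; ring
    _ ≤ 2 * Δ / ε := by gcongr; linarith

/-- The log-likelihood ratio of the history between `a` being optimal and no arm being optimal. -/
def logRatio (Δ : ℝ) (a : Fin n) (as : Fin t → Fin n) (rs : Fin t → Bool) : ℝ :=
  ∑ s, if as s = a then rewSign (rs s) * logOdds Δ else 0

lemma rewP_eq (h0 : 0 < Δ) (h1 : Δ < 1) (a b : Fin n) (r : Bool) :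
    rewP n Δ a b r =
      nullP Δ r * Real.exp (if b = a then rewSign r * logOdds Δ else 0) := by
  have h : (0 : ℝ) < 1 - Δ := by linarith
  have h' : (0 : ℝ) < 1 + Δ := by linarith
  cases r <;> by_cases hb : b = a <;> simp [rewP, nullP, rewSign, hb, logOdds, Real.exp_neg,
    Real.exp_log (div_pos h' h)] <;> field_simp <;> ring

lemma rewSeqP_eq (h0 : 0 < Δ) (h1 : Δ < 1) (a : Fin n) (as : Fin t → Fin n)
    (rs : Fin t → Bool) :
    rewSeqP n t Δ a as rs = (∏ s, nullP Δ (rs s)) * Real.exp (logRatio Δ a as rs) := by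
  simp_rw [rewSeqP, rewP_eq h0 h1, Finset.prod_mul_distrib, logRatio, Real.exp_sum]

lemma sum_rewP_ite (a b : Fin n) (f : Bool → ℝ) (c : ℝ) :
    ∑ r, rewP n Δ a b r * (if b = a then f r else c) =
      if b = a then (1 + Δ) / 2 * f true + (1 - Δ) / 2 * f false else c := by
  by_cases hb : b = a
  · simp only [rewP, hb, if_true, Fintype.sum_bool, Bool.false_eq_true, if_false]
    ring
  · simp only [rewP, hb, if_false, Fintype.sum_bool, if_true, Bool.false_eq_true]
    ring

lemma sum_rewSeqP_mul_logRatio (a : Fin n) (as : Fin t → Fin n) :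
    ∑ rs, rewSeqP n t Δ a as rs * logRatio Δ a as rs = pulls as a * (Δ * logOdds Δ) := by
  have h := sum_prod_mul_sum (p := fun s => rewP n Δ a (as s)) (fun s => sum_rewP _ _)
    (fun s r => if as s = a then rewSign r * logOdds Δ else 0)
  simp only [sum_rewP_ite] at h
  refine h.trans ?_
  rw [← sum_ite_pulls]
  refine Finset.sum_congr rfl fun s _ => ?_
  split_ifs
  · simp [rewSign]; ring
  · rfl

lemma sum_rewSeqP_mul_sq_logRatio_le (a : Fin n) (as : Fin t → Fin n) :
    ∑ rs, rewSeqP n t Δ a as rs * logRatio Δ a as rs ^ 2 ≤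
      (pulls as a + (pulls as a * Δ) ^ 2) * logOdds Δ ^ 2 := by
  have h := sum_prod_mul_sq_sum_le (p := fun s => rewP n Δ a (as s)) (fun s => sum_rewP _ _)
    (fun s r => if as s = a then rewSign r * logOdds Δ else 0)
  refine h.trans (le_of_eq ?_)
  have h1 : ∑ s, ∑ r, rewP n Δ a (as s) r *
      (if as s = a then rewSign r * logOdds Δ else 0) = pulls as a * (Δ * logOdds Δ) := by
    rw [← sum_ite_pulls]
    refine Finset.sum_congr rfl fun s _ => ?_
    rw [sum_rewP_ite]
    split_ifs
    · simp [rewSign]; ring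
    · rfl
  have h2 : ∑ s, ∑ r, rewP n Δ a (as s) r *
      (if as s = a then rewSign r * logOdds Δ else 0) ^ 2 = pulls as a * logOdds Δ ^ 2 := by
    rw [← sum_ite_pulls]
    refine Finset.sum_congr rfl fun s _ => ?_
    simp only [ite_pow]
    rw [sum_rewP_ite]
    split_ifs
    · simp [rewSign]; ring
    · simp
  rw [h1, h2]
  ring

end Rewards

section SuccessUpper

variable {n t : ℕ} {Δ : ℝ}

lemma sum_sum_rewSeqP_mul_le (h0 : 0 < Δ) (h1 : Δ < 1) (as : Fin t → Fin n)
    {out : (Fin t → Bool) → Fin n → ℝ} (hout : ∀ rs, (∀ a, 0 ≤ out rs a) ∧ ∑ a, out rs a = 1)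
    (l : ℝ) :
    ∑ a, ∑ rs, rewSeqP n t Δ a as rs * out rs a ≤ Real.exp l +
      ∑ a, ∑ rs, if l < logRatio Δ a as rs then rewSeqP n t Δ a as rs else 0 := by
  have hQ : ∀ rs : Fin t → Bool, 0 < ∏ s, nullP Δ (rs s) := fun rs =>
    Finset.prod_pos fun _ _ => nullP_pos h0 h1 _
  have key : ∀ a rs, rewSeqP n t Δ a as rs * out rs a ≤
      Real.exp l * ((∏ s, nullP Δ (rs s)) * out rs a) +
        if l < logRatio Δ a as rs then rewSeqP n t Δ a as rs else 0 := by
    intro a rs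
    have ho := (hout rs).1 a
    have ho1 : out rs a ≤ 1 := (hout rs).2 ▸
      Finset.single_le_sum (fun b _ => (hout rs).1 b) (Finset.mem_univ a)
    split_ifs with hl
    · have h2 := mul_le_of_le_one_right (rewSeqP_pos h0 h1 a as rs).le ho1
      have h3 : 0 ≤ Real.exp l * ((∏ s, nullP Δ (rs s)) * out rs a) :=
        mul_nonneg (Real.exp_pos _).le (mul_nonneg (hQ rs).le ho)
      linarith
    · rw [rewSeqP_eq h0 h1, add_zero, mul_comm (∏ s, nullP Δ (rs s)), mul_assoc]
      exact mul_le_mul_of_nonneg_right (Real.exp_le_exp.2 (not_lt.1 hl))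
        (mul_nonneg (hQ rs).le ho)
  refine (Finset.sum_le_sum fun a _ => Finset.sum_le_sum fun rs _ => key a rs).trans
    (le_of_eq ?_)
  simp_rw [Finset.sum_add_distrib]
  congr 1
  rw [Finset.sum_comm]
  simp_rw [← Finset.mul_sum, (hout _).2, mul_one]
  rw [sum_prod_eq_one fun _ => sum_nullP, mul_one]

lemma sum_ite_logRatio_le {ε : ℝ} (hε : 0 < ε) (h0 : 0 < Δ) (h1 : Δ ≤ 1 - ε) {L : ℝ}
    (hL : 0 ≤ L) (a : Fin n) (as : Fin t → Fin n) :
    (∑ rs, if 1 + L / 2 < logRatio Δ a as rs then rewSeqP n t Δ a as rs else 0) ≤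
      (32 / ε ^ 2 + 1) * (pulls as a * Δ ^ 2 / (1 + L)) := by
  have h1' : Δ < 1 := by linarith
  set y : ℝ := pulls as a * Δ ^ 2 with hy
  have hy0 : 0 ≤ y := by positivity
  have hone : (∑ rs, if 1 + L / 2 < logRatio Δ a as rs then rewSeqP n t Δ a as rs else 0) ≤ 1 := by
    rw [← sum_rewSeqP (Δ := Δ) a as]
    refine Finset.sum_le_sum fun rs _ => ?_
    split_ifs
    · exact le_rfl
    · exact (rewSeqP_pos h0 h1' a as rs).le
  rcases le_total y (1 + L) with hyL | hyL
  · have hsq : (∑ rs, if 1 + L / 2 < logRatio Δ a as rs then rewSeqP n t Δ a as rs else 0) ≤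
        (∑ rs, rewSeqP n t Δ a as rs * logRatio Δ a as rs ^ 2) / (1 + L / 2) ^ 2 := by
      rw [Finset.sum_div]
      refine Finset.sum_le_sum fun rs _ => ?_
      have hp := rewSeqP_pos h0 h1' a as rs
      split_ifs with hl
      · rw [le_div_iff₀ (by positivity)]
        gcongr
      · positivity
    have hlo : logOdds Δ ^ 2 ≤ 4 * Δ ^ 2 / ε ^ 2 := by
      calc logOdds Δ ^ 2 ≤ (2 * Δ / ε) ^ 2 :=
            pow_le_pow_left₀ (logOdds_pos h0 h1').le (logOdds_le hε h0 h1) 2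
        _ = _ := by ring
    calc _ ≤ ((pulls as a + (pulls as a * Δ) ^ 2) * logOdds Δ ^ 2) / (1 + L / 2) ^ 2 := by
          refine hsq.trans ?_
          gcongr
          exact sum_rewSeqP_mul_sq_logRatio_le a as
      _ ≤ ((pulls as a + (pulls as a * Δ) ^ 2) * (4 * Δ ^ 2 / ε ^ 2)) / (1 + L / 2) ^ 2 := by
          gcongr
      _ = 4 / ε ^ 2 * (y * (1 + y) / (1 + L / 2) ^ 2) := by rw [hy]; ring
      _ ≤ 4 / ε ^ 2 * (8 * (y / (1 + L))) := by
          gcongr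
          rw [← mul_div_assoc, div_le_div_iff₀ (by positivity) (by positivity)]
          have : (1 + y) * (1 + L) ≤ 8 * (1 + L / 2) ^ 2 := by nlinarith
          nlinarith
      _ ≤ _ := by
          have : 0 ≤ y / (1 + L) := by positivity
          rw [add_mul, one_mul, ← mul_assoc]
          refine le_trans (le_of_eq ?_) (le_add_of_nonneg_right this)
          ring
  · refine hone.trans ?_
    have : 1 ≤ y / (1 + L) := by rwa [one_le_div (by positivity)]
    have h32 : 0 ≤ 32 / ε ^ 2 := by positivity
    nlinarith

lemma exp_half_le {L : ℝ} (hL : 0 < L) : Real.exp (L / 2) ≤ (Real.exp L - 1) / L := by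
  have h := Real.self_le_sinh_iff.2 (by positivity : 0 ≤ L / 2)
  rw [Real.sinh_eq] at h
  have he : Real.exp L = Real.exp (L / 2) * Real.exp (L / 2) := by
    rw [← Real.exp_add]; ring_nf
  have hi : Real.exp (L / 2) * Real.exp (-(L / 2)) = 1 := by
    rw [← Real.exp_add]; simp
  rw [le_div_iff₀ hL, he]
  nlinarith [Real.exp_pos (L / 2)]

lemma niSuccProb_le {ε : ℝ} (hε : 0 < ε) (h0 : 0 < Δ) (h1 : Δ ≤ 1 - ε) (ht : 1 ≤ t)
    {ν : (Fin t → Fin n) → ℝ} {out : (Fin t → Fin n) → (Fin t → Bool) → Fin n → ℝ}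
    (hν : IsNIPulls n t ν) (hout : IsNIOut n t out) :
    niSuccProb n t ν out Δ ≤
      (32 / ε ^ 2 + 4) * t * Δ ^ 2 / ((n : ℝ) * Real.log (1 + t * Δ ^ 2)) := by
  have h1' : Δ < 1 := by linarith
  have ht0 : (0 : ℝ) < t := by exact_mod_cast ht
  set x : ℝ := t * Δ ^ 2 with hx
  have hx0 : 0 < x := by positivity
  set L := Real.log (1 + x) with hLdef
  have hL : 0 < L := Real.log_pos (by linarith)
  have hexp : Real.exp L = 1 + x := Real.exp_log (by linarith)
  have hfix : ∀ as : Fin t → Fin n, ∑ a, ∑ rs, rewSeqP n t Δ a as rs * out as rs a ≤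
      (32 / ε ^ 2 + 4) * (x / L) := by
    intro as
    refine (sum_sum_rewSeqP_mul_le h0 h1' as (hout as) (1 + L / 2)).trans ?_
    have hA : Real.exp (1 + L / 2) ≤ 3 * (x / L) := by
      rw [Real.exp_add]
      have := exp_half_le hL
      rw [hexp, add_sub_cancel_left] at this
      exact mul_le_mul (Real.exp_one_lt_d9.le.trans (by norm_num)) this (Real.exp_pos _).le
        (by norm_num)
    have hB : (∑ a, ∑ rs, if 1 + L / 2 < logRatio Δ a as rs then rewSeqP n t Δ a as rs else 0) ≤
        (32 / ε ^ 2 + 1) * (x / L) := by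
      refine (Finset.sum_le_sum fun a _ => sum_ite_logRatio_le hε h0 h1 hL.le a as).trans ?_
      rw [← Finset.mul_sum, ← Finset.sum_div, ← Finset.sum_mul, ← Nat.cast_sum, sum_pulls]
      gcongr
      linarith
    linarith
  have hswap : niSuccProb n t ν out Δ =
      (n : ℝ)⁻¹ * ∑ as, ν as * ∑ a, ∑ rs, rewSeqP n t Δ a as rs * out as rs a := by
    unfold niSuccProb
    rw [Finset.sum_comm]
    simp_rw [Finset.mul_sum, mul_assoc]
  rw [hswap]
  calc _ ≤ (n : ℝ)⁻¹ * ∑ as, ν as * ((32 / ε ^ 2 + 4) * (x / L)) := by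
        gcongr with as
        · exact hν.1 as
        · exact hfix as
    _ = (n : ℝ)⁻¹ * ((32 / ε ^ 2 + 4) * (x / L)) := by
        rw [← Finset.sum_mul, hν.2, one_mul]
    _ = _ := by
        rw [mul_assoc _ (t : ℝ), ← hx, mul_comm (n : ℝ) L, ← div_div]
        ring

end SuccessUpper

section InformationUpper

variable {n t : ℕ} {Δ : ℝ}

lemma mul_log_div_le {p m q : ℝ} (hp : 0 ≤ p) (hm : 0 < m) (hq : 0 < q) :
    p * Real.log (p / m) ≤ p * Real.log (p / q) + p * (q / m - 1) := by
  rcases hp.eq_or_lt with rfl | hp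
  · simp
  have h := Real.log_le_sub_one_of_pos (div_pos hq hm)
  rw [Real.log_div hq.ne' hm.ne'] at h
  rw [Real.log_div hp.ne' hm.ne', Real.log_div hp.ne' hq.ne', ← mul_add]
  gcongr
  linarith

/-- The information about the best arm gained from a fixed sequence of pulls. -/
def fixedInfo (n t : ℕ) (Δ : ℝ) (as : Fin t → Fin n) : ℝ :=
  ∑ a, ∑ rs, (n : ℝ)⁻¹ * rewSeqP n t Δ a as rs *
    Real.log (rewSeqP n t Δ a as rs / ((n : ℝ)⁻¹ * ∑ b, rewSeqP n t Δ b as rs))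

lemma niMutualInfo_eq (ν : (Fin t → Fin n) → ℝ) :
    niMutualInfo n t ν Δ = ∑ as, ν as * fixedInfo n t Δ as := by
  unfold niMutualInfo fixedInfo
  rw [Finset.sum_comm]
  refine Finset.sum_congr rfl fun as _ => ?_
  rw [Finset.mul_sum]
  refine Finset.sum_congr rfl fun a _ => ?_
  rw [Finset.mul_sum]
  refine Finset.sum_congr rfl fun rs _ => ?_
  rcases eq_or_ne (ν as) 0 with h | h
  · simp [h]
  · rw [← Finset.mul_sum, mul_left_comm (n : ℝ)⁻¹ (ν as) (∑ b, _), mul_div_mul_left _ _ h]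
    ring

lemma mixture_pos (hn : 0 < n) (h0 : 0 < Δ) (h1 : Δ < 1) (as : Fin t → Fin n)
    (rs : Fin t → Bool) : 0 < (n : ℝ)⁻¹ * ∑ b, rewSeqP n t Δ b as rs := by
  have : Nonempty (Fin n) := ⟨⟨0, hn⟩⟩
  have hn' : (0 : ℝ) < n := by exact_mod_cast hn
  exact mul_pos (inv_pos.2 hn')
    (Finset.sum_pos (fun b _ => rewSeqP_pos h0 h1 b as rs) Finset.univ_nonempty)

lemma sum_mixture (hn : 0 < n) (as : Fin t → Fin n) :
    ∑ rs, (n : ℝ)⁻¹ * ∑ b, rewSeqP n t Δ b as rs = 1 := by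
  have hn' : (n : ℝ) ≠ 0 := by exact_mod_cast hn.ne'
  rw [← Finset.mul_sum, Finset.sum_comm]
  simp_rw [sum_rewSeqP]
  simp [hn']

lemma fixedInfo_le {ε : ℝ} (hε : 0 < ε) (h0 : 0 < Δ) (h1 : Δ ≤ 1 - ε) (hn : 0 < n)
    (as : Fin t → Fin n) : fixedInfo n t Δ as ≤ 2 / ε * t * Δ ^ 2 / n := by
  have h1' : Δ < 1 := by linarith
  set q : (Fin t → Bool) → ℝ := fun rs => ∏ s, nullP Δ (rs s) with hq
  have hqpos : ∀ rs, 0 < q rs := fun rs => Finset.prod_pos fun _ _ => nullP_pos h0 h1' _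
  set m : (Fin t → Bool) → ℝ := fun rs => (n : ℝ)⁻¹ * ∑ b, rewSeqP n t Δ b as rs with hm
  have hmpos : ∀ rs, 0 < m rs := mixture_pos hn h0 h1' as
  have hterm : ∀ a rs, (n : ℝ)⁻¹ * rewSeqP n t Δ a as rs *
      Real.log (rewSeqP n t Δ a as rs / m rs) ≤
      (n : ℝ)⁻¹ * (rewSeqP n t Δ a as rs * logRatio Δ a as rs) +
        (n : ℝ)⁻¹ * rewSeqP n t Δ a as rs * (q rs / m rs - 1) := by
    intro a rs
    have h := mul_log_div_le (rewSeqP_pos h0 h1' a as rs).le (hmpos rs) (hqpos rs)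
    have hr : rewSeqP n t Δ a as rs / q rs = Real.exp (logRatio Δ a as rs) := by
      rw [rewSeqP_eq h0 h1', mul_div_cancel_left₀ _ (hqpos rs).ne']
    rw [hr, Real.log_exp] at h
    rw [mul_assoc, mul_assoc, ← mul_add]
    gcongr
  have hrest : ∑ a, ∑ rs, (n : ℝ)⁻¹ * rewSeqP n t Δ a as rs * (q rs / m rs - 1) = 0 := by
    rw [Finset.sum_comm]
    have : ∀ rs, ∑ a, (n : ℝ)⁻¹ * rewSeqP n t Δ a as rs * (q rs / m rs - 1) = q rs - m rs := by
      intro rs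
      rw [← Finset.sum_mul, ← Finset.mul_sum]
      change m rs * _ = _
      field_simp [(hmpos rs).ne']
    simp_rw [this, Finset.sum_sub_distrib]
    rw [sum_prod_eq_one fun _ => sum_nullP, sum_mixture hn, sub_self]
  have hmain : ∑ a, ∑ rs, (n : ℝ)⁻¹ * (rewSeqP n t Δ a as rs * logRatio Δ a as rs) =
      (n : ℝ)⁻¹ * (t * (Δ * logOdds Δ)) := by
    simp_rw [← Finset.mul_sum, sum_rewSeqP_mul_logRatio]
    rw [← Finset.sum_mul, ← Nat.cast_sum, sum_pulls]
  calc fixedInfo n t Δ as ≤ _ :=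
        Finset.sum_le_sum fun a _ => Finset.sum_le_sum fun rs _ => hterm a rs
    _ = (n : ℝ)⁻¹ * (t * (Δ * logOdds Δ)) := by
        simp_rw [Finset.sum_add_distrib]
        rw [hrest, hmain, add_zero]
    _ ≤ (n : ℝ)⁻¹ * (t * (Δ * (2 * Δ / ε))) := by
        gcongr
        exact logOdds_le hε h0 h1
    _ = _ := by ring

lemma niMutualInfo_le {ε : ℝ} (hε : 0 < ε) (h0 : 0 < Δ) (h1 : Δ ≤ 1 - ε) (hn : 0 < n)
    {ν : (Fin t → Fin n) → ℝ} (hν : IsNIPulls n t ν) :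
    niMutualInfo n t ν Δ ≤ 2 / ε * t * Δ ^ 2 / n := by
  rw [niMutualInfo_eq]
  calc _ ≤ ∑ as, ν as * (2 / ε * t * Δ ^ 2 / n) :=
        Finset.sum_le_sum fun as _ =>
          mul_le_mul_of_nonneg_left (fixedInfo_le hε h0 h1 hn as) (hν.1 as)
    _ = _ := by rw [← Finset.sum_mul, hν.2, one_mul]

end InformationUpper

section Blocks

variable {n t : ℕ}

/-- The pull sequence that pulls the arms in consecutive blocks of length `m`, and the last arm
once all blocks are exhausted. -/
def blockPulls (hn : 0 < n) (m : ℕ) : Fin t → Fin n :=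
  fun s => ⟨min (s / m) (n - 1), by omega⟩

lemma le_pulls_blockPulls (hn : 0 < n) {m : ℕ} {b : Fin n} (hb : (b + 1) * m ≤ t) :
    m ≤ pulls (blockPulls (t := t) hn m) b := by
  have hlt : ∀ j : Fin m, (b : ℕ) * m + j < t := fun j => by
    have := j.2
    rw [add_mul] at hb
    omega
  have hcard := Finset.card_le_card_of_injOn (s := (Finset.univ : Finset (Fin m)))
    (t := Finset.univ.filter fun s => blockPulls (t := t) hn m s = b)
    (fun j => ⟨b * m + j, hlt j⟩) ?_ ?_
  · simpa [pulls] using hcard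
  · intro j _
    have hm : 0 < m := j.pos
    have hdiv : ((b : ℕ) * m + j) / m = b := by
      rw [mul_comm, Nat.mul_add_div hm, Nat.div_eq_of_lt j.2, add_zero]
    have hbn := b.2
    simp only [Finset.coe_filter, Finset.mem_univ, true_and, Set.mem_ofPred_eq, blockPulls,
      hdiv, Fin.ext_iff]
    omega
  · intro i _ j _ hij
    simp only [Fin.mk.injEq] at hij
    exact Fin.ext (by omega)

lemma pulls_blockPulls_le (hn : 0 < n) {m : ℕ} (hm : 0 < m) (ht : t ≤ n * m) (b : Fin n) :
    pulls (blockPulls (t := t) hn m) b ≤ m := by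
  have hdiv : ∀ s : Fin t, blockPulls hn m s = b → (s : ℕ) / m = b := by
    intro s hs
    have hlt : (s : ℕ) / m < n := by
      rw [Nat.div_lt_iff_lt_mul hm]
      exact s.2.trans_le ht
    simp only [blockPulls, Fin.ext_iff] at hs
    omega
  have hcard := Finset.card_le_card_of_injOn
    (s := Finset.univ.filter fun s => blockPulls (t := t) hn m s = b)
    (t := Finset.range m) (fun s => (s : ℕ) % m) ?_ ?_
  · simpa [pulls] using hcard
  · intro s _
    simpa using Nat.mod_lt _ hm
  · intro i hi j hj hij
    simp only [Finset.coe_filter, Finset.mem_univ, true_and, Set.mem_ofPred_eq] at hi hj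
    have h := (hdiv i hi).trans (hdiv j hj).symm
    refine Fin.ext ?_
    rw [← Nat.div_add_mod (i : ℕ) m, ← Nat.div_add_mod (j : ℕ) m, h]
    exact congrArg _ hij

end Blocks

section SuccessLower

variable {n t : ℕ} {Δ : ℝ}

lemma sum_rewSeqP_mul_prod_ite (a b : Fin n) (as : Fin t → Fin n) (f : Bool → ℝ) :
    ∑ rs, rewSeqP n t Δ a as rs * ∏ s, (if as s = b then f (rs s) else 1) =
      (∑ r, rewP n Δ a b r * f r) ^ pulls as b := by
  have h := sum_prod_mul_prod (fun s => rewP n Δ a (as s))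
    (fun s r => if as s = b then f r else 1)
  refine h.trans ?_
  rw [← prod_ite_pulls]
  refine Finset.prod_congr rfl fun s _ => ?_
  split_ifs with hs
  · rw [hs]
  · simpa using sum_rewP _ _

/-- The point mass at a pull sequence. -/
def purePulls (as : Fin t → Fin n) : (Fin t → Fin n) → ℝ := fun x => if x = as then 1 else 0

lemma isNIPulls_purePulls (as : Fin t → Fin n) : IsNIPulls n t (purePulls as) := by
  refine ⟨fun x => ?_, by simp [purePulls]⟩
  unfold purePulls
  split_ifs <;> norm_num

lemma niSuccProb_purePulls (as : Fin t → Fin n)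
    (out : (Fin t → Fin n) → (Fin t → Bool) → Fin n → ℝ) :
    niSuccProb n t (purePulls as) out Δ =
      (n : ℝ)⁻¹ * ∑ a, ∑ rs, rewSeqP n t Δ a as rs * out as rs a := by
  unfold niSuccProb
  congr 1
  refine Finset.sum_congr rfl fun a _ => ?_
  rw [Finset.sum_eq_single as]
  · simp [purePulls]
  · intro x _ hx
    simp [purePulls, hx]
  · simp

/-- An evidence weight for an arm: its mean is `1 - Δ²/2` per pull of a suboptimal arm, and so is
the mean of its inverse per pull of the optimal arm. -/
def evidence (Δ : ℝ) (as : Fin t → Fin n) (b : Fin n) (rs : Fin t → Bool) : ℝ :=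
  ∏ s, if as s = b then (if rs s then (1 - Δ)⁻¹ else 1 - Δ) else 1

lemma evidence_pos (h1 : Δ < 1) (as : Fin t → Fin n) (b : Fin n) (rs : Fin t → Bool) :
    0 < evidence Δ as b rs := by
  have : 0 < 1 - Δ := by linarith
  refine Finset.prod_pos fun s _ => ?_
  split_ifs <;> positivity

lemma sum_rewSeqP_mul_evidence (h1 : Δ < 1) {a b : Fin n} (hab : a ≠ b)
    (as : Fin t → Fin n) :
    ∑ rs, rewSeqP n t Δ a as rs * evidence Δ as b rs = (1 - Δ ^ 2 / 2) ^ pulls as b := by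
  have : (1 - Δ) ≠ 0 := by linarith
  refine (sum_rewSeqP_mul_prod_ite a b as fun r => if r then (1 - Δ)⁻¹ else 1 - Δ).trans ?_
  congr 1
  simp [rewP, hab.symm]
  field_simp
  ring

lemma sum_rewSeqP_mul_inv_evidence (h1 : Δ < 1) (a : Fin n) (as : Fin t → Fin n) :
    ∑ rs, rewSeqP n t Δ a as rs * (evidence Δ as a rs)⁻¹ = (1 - Δ ^ 2 / 2) ^ pulls as a := by
  have : (1 - Δ) ≠ 0 := by linarith
  have h := sum_rewSeqP_mul_prod_ite (Δ := Δ) a a as fun r => if r then 1 - Δ else (1 - Δ)⁻¹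
  have hinv : ∀ rs : Fin t → Bool, (evidence Δ as a rs)⁻¹ =
      ∏ s, if as s = a then (if rs s then 1 - Δ else (1 - Δ)⁻¹) else 1 := by
    intro rs
    rw [evidence, ← Finset.prod_inv_distrib]
    refine Finset.prod_congr rfl fun s _ => ?_
    split_ifs <;> simp
  simp_rw [hinv]
  refine h.trans ?_
  congr 1
  simp [rewP]
  field_simp
  ring

open Classical in
/-- An arm of `A` whose evidence is at least `1`, if there is one. -/
def pickArm (hn : 0 < n) (Δ : ℝ) (A : Finset (Fin n)) (as : Fin t → Fin n)
    (rs : Fin t → Bool) : Fin n :=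
  if h : ∃ b, b ∈ A ∧ 1 ≤ evidence Δ as b rs then h.choose else ⟨0, hn⟩

lemma le_ite_pickArm (hn : 0 < n) (h1 : Δ < 1) {A : Finset (Fin n)} {a : Fin n} (ha : a ∈ A)
    (as : Fin t → Fin n) (rs : Fin t → Bool) :
    1 - ((evidence Δ as a rs)⁻¹ + ∑ b ∈ A.erase a, evidence Δ as b rs) ≤
      if a = pickArm hn Δ A as rs then 1 else 0 := by
  have hpos := evidence_pos (n := n) (t := t) h1 as
  have hinv : 0 < (evidence Δ as a rs)⁻¹ := inv_pos.2 (hpos a rs)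
  have hsum : 0 ≤ ∑ b ∈ A.erase a, evidence Δ as b rs :=
    Finset.sum_nonneg fun b _ => (hpos b rs).le
  split_ifs with hp
  · linarith
  by_cases hga : 1 ≤ evidence Δ as a rs
  · have hex : ∃ b, b ∈ A ∧ 1 ≤ evidence Δ as b rs := ⟨a, ha, hga⟩
    rw [pickArm, dif_pos hex] at hp
    have hle := Finset.single_le_sum (f := fun b => evidence Δ as b rs)
      (fun b _ => (hpos b rs).le)
      (Finset.mem_erase.2 ⟨fun h => hp h.symm, hex.choose_spec.1⟩)
    have := hex.choose_spec.2
    linarith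
  · have := (one_le_inv₀ (hpos a rs)).2 (not_le.1 hga).le
    linarith

lemma le_niSuccProb_pickArm (hn : 0 < n) (h0 : 0 < Δ) (h1 : Δ < 1) (A : Finset (Fin n))
    (as : Fin t → Fin n) {m : ℕ} (hm : ∀ b ∈ A, m ≤ pulls as b) :
    (n : ℝ)⁻¹ * (A.card * (1 - A.card * Real.exp (-(m * Δ ^ 2 / 2)))) ≤
      niSuccProb n t (purePulls as)
        (fun as rs a => if a = pickArm hn Δ A as rs then 1 else 0) Δ := by
  rw [niSuccProb_purePulls]
  gcongr
  have hpow : ∀ b ∈ A, (1 - Δ ^ 2 / 2) ^ pulls as b ≤ Real.exp (-(m * Δ ^ 2 / 2)) := by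
    intro b hb
    have hΔ : 0 ≤ 1 - Δ ^ 2 / 2 := by nlinarith
    calc (1 - Δ ^ 2 / 2) ^ pulls as b ≤ (1 - Δ ^ 2 / 2) ^ m :=
          pow_le_pow_of_le_one hΔ (by nlinarith) (hm b hb)
      _ ≤ Real.exp (-(Δ ^ 2 / 2)) ^ m := by
          gcongr
          exact Real.one_sub_le_exp_neg _
      _ = _ := by rw [← Real.exp_nat_mul]; ring_nf
  have harm : ∀ a ∈ A, 1 - A.card * Real.exp (-(m * Δ ^ 2 / 2)) ≤
      ∑ rs, rewSeqP n t Δ a as rs * if a = pickArm hn Δ A as rs then 1 else 0 := by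
    intro a ha
    calc _ ≤ 1 - ∑ b ∈ A, (1 - Δ ^ 2 / 2) ^ pulls as b := by
          have := Finset.sum_le_card_nsmul A _ _ hpow
          rw [nsmul_eq_mul] at this
          linarith
      _ = ∑ rs, rewSeqP n t Δ a as rs *
          (1 - ((evidence Δ as a rs)⁻¹ + ∑ b ∈ A.erase a, evidence Δ as b rs)) := by
          simp_rw [mul_sub, mul_add, mul_one, Finset.sum_sub_distrib, Finset.sum_add_distrib]
          rw [sum_rewSeqP, sum_rewSeqP_mul_inv_evidence h1, ← Finset.add_sum_erase A _ ha]
          congr 2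
          simp_rw [Finset.mul_sum]
          rw [Finset.sum_comm]
          exact Finset.sum_congr rfl fun b hb =>
            (sum_rewSeqP_mul_evidence h1 (Finset.ne_of_mem_erase hb).symm as).symm
      _ ≤ _ := Finset.sum_le_sum fun rs _ => mul_le_mul_of_nonneg_left
          (le_ite_pickArm hn h1 ha as rs) (rewSeqP_pos h0 h1 a as rs).le
  calc _ = ∑ _a ∈ A, (1 - A.card * Real.exp (-(m * Δ ^ 2 / 2))) := by
        rw [Finset.sum_const, nsmul_eq_mul]
    _ ≤ _ := Finset.sum_le_sum harm
    _ ≤ _ := Finset.sum_le_sum_of_subset_of_nonneg (Finset.subset_univ A) fun a _ _ =>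
        Finset.sum_nonneg fun rs _ => mul_nonneg (rewSeqP_pos h0 h1 a as rs).le
          (by split_ifs <;> norm_num)

lemma niSuccProb_le_pStarNI {ε : ℝ} (hε : 0 < ε) (h0 : 0 < Δ) (h1 : Δ ≤ 1 - ε) (ht : 1 ≤ t)
    {ν : (Fin t → Fin n) → ℝ} {out : (Fin t → Fin n) → (Fin t → Bool) → Fin n → ℝ}
    (hν : IsNIPulls n t ν) (hout : IsNIOut n t out) :
    niSuccProb n t ν out Δ ≤ pStarNI n t Δ := by
  refine le_csSup ⟨(32 / ε ^ 2 + 4) * t * Δ ^ 2 / ((n : ℝ) * Real.log (1 + t * Δ ^ 2)), ?_⟩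
    ⟨ν, out, hν, hout, rfl⟩
  rintro _ ⟨ν', out', hν', hout', rfl⟩
  exact niSuccProb_le hε h0 h1 ht hν' hout'

lemma isNIOut_ite (f : (Fin t → Fin n) → (Fin t → Bool) → Fin n) :
    IsNIOut n t (fun as rs a => if a = f as rs then 1 else 0) := by
  refine fun as rs => ⟨fun a => ?_, by simp⟩
  dsimp only
  split_ifs <;> norm_num

lemma inv_le_pStarNI {ε : ℝ} (hε : 0 < ε) (hn : 0 < n) (h0 : 0 < Δ) (h1 : Δ ≤ 1 - ε)
    (ht : 1 ≤ t) : (n : ℝ)⁻¹ ≤ pStarNI n t Δ := by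
  refine le_trans (le_of_eq ?_) (niSuccProb_le_pStarNI hε h0 h1 ht
    (isNIPulls_purePulls fun _ => ⟨0, hn⟩) (isNIOut_ite fun _ _ => ⟨0, hn⟩))
  rw [niSuccProb_purePulls]
  simp [sum_rewSeqP]

lemma le_pStarNI {ε : ℝ} (hε : 0 < ε) (hn : 2 ≤ n) (h0 : 0 < Δ) (h1 : Δ ≤ 1 - ε)
    (ht : 1 ≤ t) (htn : (t : ℝ) ≤ n * Real.log n / Δ ^ 2) :
    1 / 128 * t * Δ ^ 2 / ((n : ℝ) * Real.log (1 + t * Δ ^ 2)) ≤ pStarNI n t Δ := by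
  have h1' : Δ < 1 := by linarith
  have hn0 : (0 : ℝ) < n := by exact_mod_cast (by omega : 0 < n)
  have ht0 : (0 : ℝ) < t := by exact_mod_cast ht
  rw [le_div_iff₀ (by positivity)] at htn
  rw [mul_assoc (1 / 128 : ℝ)]
  have hxt : t * Δ ^ 2 ≤ t := mul_le_of_le_one_right ht0.le (by nlinarith)
  have hx0 : 0 < t * Δ ^ 2 := by positivity
  set x : ℝ := t * Δ ^ 2 with hx
  set L := Real.log (1 + x) with hLdef
  have hL : 0 < L := Real.log_pos (by linarith)
  have hexp : Real.exp L = 1 + x := Real.exp_log (by linarith)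
  have hgoal : 1 / 128 * x / (n * L) = (n : ℝ)⁻¹ * (1 / 128 * (x / L)) := by
    field_simp
  rw [hgoal]
  rcases lt_or_ge x (8 * L) with hsmall | hlarge
  · refine le_trans ?_ (inv_le_pStarNI hε (by omega) h0 h1 ht)
    refine mul_le_of_le_one_right (by positivity) ?_
    have : x / L < 8 := by rwa [div_lt_iff₀ hL]
    linarith
  have hLx : x / (1 + x) ≤ L := by
    have h := Real.one_sub_inv_le_log_of_pos (by linarith : 0 < 1 + x)
    refine le_trans (le_of_eq ?_) h
    field_simp
    ring
  have hx7 : 7 ≤ x := by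
    rw [div_le_iff₀ (by linarith)] at hLx
    nlinarith
  have hL1 : 1 ≤ L := by
    rw [hLdef, Real.le_log_iff_exp_le (by linarith)]
    exact Real.exp_one_lt_d9.le.trans (by linarith)
  set k : ℕ := ⌊x / (8 * L)⌋₊ with hk
  have hone : 1 ≤ x / (8 * L) := by rwa [one_le_div (by positivity)]
  have hk1 : 1 ≤ k := Nat.le_floor (by exact_mod_cast hone)
  have hk0 : (0 : ℝ) < k := by exact_mod_cast hk1
  have hkle : (k : ℝ) ≤ x / (8 * L) := Nat.floor_le (by positivity)
  have hkge : x / (8 * L) ≤ 2 * k := by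
    have := (Nat.lt_floor_add_one (x / (8 * L))).le
    have h1k : (1 : ℝ) ≤ k := by exact_mod_cast hk1
    linarith
  have hkL : k * (8 * L) ≤ x := by rwa [le_div_iff₀ (by positivity)] at hkle
  have hkn : k ≤ n := by
    have : (k : ℝ) ≤ n := by
      rcases le_total x n with hxn | hxn
      · nlinarith
      · have hlog : Real.log n ≤ L := Real.log_le_log hn0 (by linarith)
        have : x ≤ n * L := htn.trans (mul_le_mul_of_nonneg_left hlog hn0.le)
        by_contra! hcon
        nlinarith
    exact_mod_cast this
  have hkt : k ≤ t := by
    have : (k : ℝ) ≤ t := by nlinarith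
    exact_mod_cast this
  set m := t / k with hm
  have hmk : k * m ≤ t := Nat.mul_div_le t k
  have hmt : (t : ℝ) ≤ 2 * (k * m) := by
    have h2 : t < k * (m + 1) := Nat.lt_mul_div_succ t hk1
    have h3 : 1 ≤ m := Nat.div_pos hkt hk1
    have : t ≤ 2 * (k * m) := by nlinarith
    exact_mod_cast this
  have hmL : 2 * L ≤ m * Δ ^ 2 / 2 := by
    have h2 : x ≤ 2 * (k * (m * Δ ^ 2)) := by
      rw [hx]; nlinarith [sq_nonneg Δ]
    have h3 : k * (8 * L) ≤ k * (2 * (m * Δ ^ 2)) := by linarith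
    have := le_of_mul_le_mul_left h3 hk0
    linarith
  have herr : k * Real.exp (-(m * Δ ^ 2 / 2)) ≤ 1 / 2 := by
    calc k * Real.exp (-(m * Δ ^ 2 / 2)) ≤ (1 + x) * Real.exp (-(2 * L)) := by
          gcongr
          nlinarith
      _ = (1 + x)⁻¹ := by
          rw [show -(2 * L) = -L + -L by ring, Real.exp_add, Real.exp_neg, hexp]
          field_simp
      _ ≤ 1 / 2 := by
          rw [one_div]
          gcongr
          linarith
  set A : Finset (Fin n) := Finset.univ.filter fun b => (b : ℕ) < k with hA
  have hcard : A.card = k := by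
    rw [hA, Fin.card_filter_val_lt, min_eq_right hkn]
  have hpulls : ∀ b ∈ A, m ≤ pulls (blockPulls (t := t) (by omega : 0 < n) m) b := by
    intro b hb
    refine le_pulls_blockPulls _ (le_trans (Nat.mul_le_mul_right m ?_) hmk)
    simpa [hA] using hb
  refine le_trans ?_ ((le_niSuccProb_pickArm (by omega) h0 h1' A _ hpulls).trans
    (niSuccProb_le_pStarNI hε h0 h1 ht (isNIPulls_purePulls _) (isNIOut_ite _)))
  rw [hcard]
  refine mul_le_mul_of_nonneg_left ?_ (inv_nonneg.2 hn0.le)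
  have hxL : x / L ≤ 16 * k := by
    have : x / (8 * L) = x / L / 8 := by field_simp
    linarith
  nlinarith

end SuccessLower

section InformationLower

variable {n t : ℕ} {Δ : ℝ}

lemma sub_two_mul_sq_le_log {z : ℝ} (hz : -(1 / 2) ≤ z) : z - 2 * z ^ 2 ≤ Real.log (1 + z) := by
  have hpos : 0 < 1 + z := by linarith
  refine le_trans ?_ (Real.one_sub_inv_le_log_of_pos hpos)
  have : 1 - (1 + z)⁻¹ = z / (1 + z) := by field_simp; ring
  rw [this, le_div_iff₀ hpos]
  nlinarith [mul_nonneg (sq_nonneg z) (by linarith : 0 ≤ 1 + 2 * z)]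

/-- A damped likelihood ratio for the arm `a`. -/
def dampedRatio (Δ : ℝ) (as : Fin t → Fin n) (a : Fin n) (rs : Fin t → Bool) : ℝ :=
  ∏ s, if as s = a then 1 + Δ / 16 * rewSign (rs s) else 1

lemma dampedFactor_pos (h0 : 0 < Δ) (h1 : Δ < 1) (r : Bool) :
    0 < 1 + Δ / 16 * rewSign r := by
  cases r <;> simp [rewSign] <;> linarith

lemma dampedRatio_pos (h0 : 0 < Δ) (h1 : Δ < 1) (as : Fin t → Fin n) (a : Fin n)
    (rs : Fin t → Bool) : 0 < dampedRatio Δ as a rs := by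
  refine Finset.prod_pos fun s _ => ?_
  split_ifs
  · exact dampedFactor_pos h0 h1 _
  · exact one_pos

lemma sum_rewSeqP_mul_dampedRatio_le (h0 : 0 < Δ) (h1 : Δ < 1) (a b : Fin n)
    (as : Fin t → Fin n) :
    ∑ rs, rewSeqP n t Δ b as rs * dampedRatio Δ as a rs ≤
      1 + if b = a then Real.exp (pulls as a * Δ ^ 2 / 16) - 1 else 0 := by
  refine (sum_rewSeqP_mul_prod_ite b a as fun r => 1 + Δ / 16 * rewSign r).trans_le ?_
  split_ifs with hab
  · subst hab
    have : ∑ r, rewP n Δ b b r * (1 + Δ / 16 * rewSign r) = Δ ^ 2 / 16 + 1 := by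
      simp [rewP, rewSign]
      ring
    rw [this, add_sub_cancel, mul_div_assoc, Real.exp_nat_mul]
    gcongr
    exact Real.add_one_le_exp _
  · have : ∑ r, rewP n Δ b a r * (1 + Δ / 16 * rewSign r) = 1 - Δ ^ 2 / 16 := by
      simp [rewP, rewSign, Ne.symm hab]
      ring
    rw [this, add_zero]
    exact pow_le_one₀ (by nlinarith) (by nlinarith)

lemma le_sum_rewSeqP_mul_log_dampedRatio (h0 : 0 < Δ) (h1 : Δ < 1) (a : Fin n)
    (as : Fin t → Fin n) :
    pulls as a * (7 / 128 * Δ ^ 2) ≤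
      ∑ rs, rewSeqP n t Δ a as rs * Real.log (dampedRatio Δ as a rs) := by
  have hlog : ∀ rs : Fin t → Bool, Real.log (dampedRatio Δ as a rs) =
      ∑ s, if as s = a then Real.log (1 + Δ / 16 * rewSign (rs s)) else 0 := by
    intro rs
    rw [dampedRatio, Real.log_prod]
    · refine Finset.sum_congr rfl fun s _ => ?_
      split_ifs <;> simp
    · intro s _
      split_ifs
      · exact (dampedFactor_pos h0 h1 _).ne'
      · exact one_ne_zero
  simp_rw [hlog]
  have h := sum_prod_mul_sum (p := fun s => rewP n Δ a (as s)) (fun s => sum_rewP _ _)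
    (fun s r => if as s = a then Real.log (1 + Δ / 16 * rewSign r) else 0)
  simp only [sum_rewP_ite, sum_ite_pulls] at h
  refine le_of_le_of_eq ?_ h.symm
  gcongr
  have hp := sub_two_mul_sq_le_log (z := Δ / 16 * rewSign true) (by simp [rewSign]; linarith)
  have hm := sub_two_mul_sq_le_log (z := Δ / 16 * rewSign false) (by simp [rewSign]; linarith)
  have hp' := mul_le_mul_of_nonneg_left hp (by linarith : 0 ≤ (1 + Δ) / 2)
  have hm' := mul_le_mul_of_nonneg_left hm (by linarith : 0 ≤ (1 - Δ) / 2)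
  refine le_trans (le_of_eq ?_) (add_le_add hp' hm')
  simp [rewSign]
  ring

/-- A lower bound on the information, with `dampedRatio` as a variational test function. -/
lemma le_fixedInfo (h0 : 0 < Δ) (h1 : Δ < 1) (hn : 0 < n) (as : Fin t → Fin n) :
    (n : ℝ)⁻¹ * ∑ a, (pulls as a * (7 / 128 * Δ ^ 2) -
      (Real.exp (pulls as a * Δ ^ 2 / 16) - 1) / n) ≤ fixedInfo n t Δ as := by
  have hn' : (0 : ℝ) < n := by exact_mod_cast hn
  set m : (Fin t → Bool) → ℝ := fun rs => (n : ℝ)⁻¹ * ∑ b, rewSeqP n t Δ b as rs with hm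
  have hmpos : ∀ rs, 0 < m rs := mixture_pos hn h0 h1 as
  have hterm : ∀ a rs, rewSeqP n t Δ a as rs * Real.log (dampedRatio Δ as a rs) -
      m rs * dampedRatio Δ as a rs + rewSeqP n t Δ a as rs ≤
      rewSeqP n t Δ a as rs * Real.log (rewSeqP n t Δ a as rs / m rs) := by
    intro a rs
    have hP := rewSeqP_pos h0 h1 a as rs
    have hG := dampedRatio_pos h0 h1 as a rs
    have h := Real.log_le_sub_one_of_pos (div_pos (mul_pos (hmpos rs) hG) hP)
    rw [Real.log_div (mul_pos (hmpos rs) hG).ne' hP.ne',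
      Real.log_mul (hmpos rs).ne' hG.ne'] at h
    rw [Real.log_div hP.ne' (hmpos rs).ne']
    have h' := mul_le_mul_of_nonneg_left h hP.le
    rw [mul_sub _ (_ / _), mul_div_cancel₀ _ hP.ne'] at h'
    linarith
  have hmix : ∀ a, ∑ rs, m rs * dampedRatio Δ as a rs ≤
      1 + (Real.exp (pulls as a * Δ ^ 2 / 16) - 1) / n := by
    intro a
    calc ∑ rs, m rs * dampedRatio Δ as a rs
        = (n : ℝ)⁻¹ * ∑ b, ∑ rs, rewSeqP n t Δ b as rs * dampedRatio Δ as a rs := by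
          rw [Finset.sum_comm, Finset.mul_sum]
          refine Finset.sum_congr rfl fun rs _ => ?_
          rw [← Finset.sum_mul, hm, mul_assoc]
      _ ≤ (n : ℝ)⁻¹ * ∑ b : Fin n,
          (1 + if b = a then Real.exp (pulls as a * Δ ^ 2 / 16) - 1 else 0) := by
          gcongr with b
          exact sum_rewSeqP_mul_dampedRatio_le h0 h1 a b as
      _ = _ := by
          rw [Finset.sum_add_distrib]
          simp
          field_simp
  unfold fixedInfo
  simp_rw [mul_assoc, ← Finset.mul_sum]
  gcongr with a
  refine le_trans ?_ (Finset.sum_le_sum fun rs _ => hterm a rs)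
  rw [Finset.sum_add_distrib, Finset.sum_sub_distrib, sum_rewSeqP]
  linarith [hmix a, le_sum_rewSeqP_mul_log_dampedRatio h0 h1 a as]

lemma exp_sub_one_div_le {y : ℝ} (hn : 2 ≤ n) (hy : 0 ≤ y) (hyn : y ≤ 2 * Real.log n) :
    (Real.exp (y / 16) - 1) / n ≤ 6 / 128 * y := by
  have hn' : (2 : ℝ) ≤ n := by exact_mod_cast hn
  have hn0 : (0 : ℝ) < n := by linarith
  have hmul : Real.exp (y / 16) - 1 ≤ y / 16 * Real.exp (y / 16) := by
    have h := Real.add_one_le_exp (-(y / 16))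
    have he : Real.exp (y / 16) * Real.exp (-(y / 16)) = 1 := by
      rw [← Real.exp_add]; simp
    nlinarith [Real.exp_pos (y / 16)]
  set w := Real.exp (Real.log n / 2) with hw
  have hwpos : 0 < w := Real.exp_pos _
  have hww : w * w = n := by
    rw [hw, ← Real.exp_add, add_halves, Real.exp_log hn0]
  have hlog : 0 ≤ Real.log n := Real.log_nonneg (by linarith)
  have hyw : Real.exp (y / 16) ≤ w := Real.exp_le_exp.2 (by linarith)
  have hw43 : 4 / 3 ≤ w := by nlinarith
  have hw34 : w ≤ 3 / 4 * n := by nlinarith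
  rw [div_le_iff₀ hn0]
  nlinarith

lemma niMutualInfo_purePulls (as : Fin t → Fin n) :
    niMutualInfo n t (purePulls as) Δ = fixedInfo n t Δ as := by
  simp [niMutualInfo_eq, purePulls]

lemma le_IStarNI {ε : ℝ} (hε : 0 < ε) (hn : 2 ≤ n) (h0 : 0 < Δ) (h1 : Δ ≤ 1 - ε)
    (htn : (t : ℝ) ≤ n * Real.log n / Δ ^ 2) :
    1 / 128 * t * Δ ^ 2 / n ≤ IStarNI n t Δ := by
  have h1' : Δ < 1 := by linarith
  have hnpos : 0 < n := by omega
  have hn0 : (0 : ℝ) < n := by exact_mod_cast hnpos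
  rw [le_div_iff₀ (by positivity)] at htn
  set m : ℕ := t / n + 1 with hm
  set as : Fin t → Fin n := blockPulls hnpos m with has
  have htm : t ≤ n * m := (Nat.lt_mul_div_succ t hnpos).le
  have hbound : ∀ a, pulls as a * Δ ^ 2 ≤ 2 * Real.log n := by
    intro a
    have hlog2 : 1 ≤ 2 * Real.log n := by
      have := Real.log_le_log (by norm_num) (by exact_mod_cast hn : (2 : ℝ) ≤ n)
      linarith [Real.log_two_gt_d9]
    have hΔ : Δ ^ 2 ≤ 1 := by nlinarith
    have hple : (pulls as a : ℝ) ≤ m := by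
      exact_mod_cast pulls_blockPulls_le hnpos (Nat.succ_pos _) htm a
    rcases lt_or_ge t n with hlt | hge
    · have hm1 : m = 1 := by rw [hm, Nat.div_eq_of_lt hlt]
      rw [hm1, Nat.cast_one] at hple
      nlinarith [sq_nonneg Δ]
    · have hnm : n * m ≤ 2 * t := by
        have := Nat.mul_div_le t n
        rw [hm, mul_add, mul_one]
        omega
      have hnm' : (n : ℝ) * m ≤ 2 * t := by exact_mod_cast hnm
      have h2 : n * (m * Δ ^ 2) ≤ n * (2 * Real.log n) := by
        nlinarith [sq_nonneg Δ]
      have h3 := le_of_mul_le_mul_left h2 hn0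
      nlinarith [sq_nonneg Δ]
  have hle : niMutualInfo n t (purePulls as) Δ ≤ IStarNI n t Δ := by
    refine le_csSup ⟨2 / ε * t * Δ ^ 2 / n, ?_⟩ ⟨_, isNIPulls_purePulls as, rfl⟩
    rintro _ ⟨ν', hν', rfl⟩
    exact niMutualInfo_le hε h0 h1 hnpos hν'
  rw [niMutualInfo_purePulls] at hle
  refine le_trans ?_ ((le_fixedInfo h0 h1' hnpos as).trans hle)
  calc 1 / 128 * t * Δ ^ 2 / n = (n : ℝ)⁻¹ * ∑ a, (pulls as a : ℝ) * (1 / 128 * Δ ^ 2) := by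
        rw [← Finset.sum_mul, ← Nat.cast_sum, sum_pulls]
        ring
    _ ≤ _ := by
        gcongr with a
        linarith [exp_sub_one_div_le hn (by positivity) (hbound a)]

end InformationLower

/-- Non-interactive case: for every `ε ∈ (0,1)` there are `c, C > 0` such that for all `n ≥ 2`,
`Δ ∈ (0, 1-ε]` and horizons `1 ≤ t ≤ n (log n)/Δ²`:
(i)  `c tΔ²/(n log(1+tΔ²)) ≤ p*_{t,NI} ≤ C tΔ²/(n log(1+tΔ²))`, and
(ii) `c tΔ²/n ≤ I*_{t,NI} ≤ C tΔ²/n`. -/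
theorem bandit_non_interactive :
    ∀ ε : ℝ, ε ∈ Set.Ioo (0 : ℝ) 1 → ∃ c C : ℝ, 0 < c ∧ 0 < C ∧
      ∀ n : ℕ, 2 ≤ n → ∀ Δ : ℝ, Δ ∈ Set.Ioc (0 : ℝ) (1 - ε) →
        ∀ t : ℕ, 1 ≤ t → (t : ℝ) ≤ (n : ℝ) * Real.log n / Δ ^ 2 →
          (c * t * Δ ^ 2 / ((n : ℝ) * Real.log (1 + t * Δ ^ 2)) ≤ pStarNI n t Δ ∧
            pStarNI n t Δ ≤ C * t * Δ ^ 2 / ((n : ℝ) * Real.log (1 + t * Δ ^ 2))) ∧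
          (c * t * Δ ^ 2 / n ≤ IStarNI n t Δ ∧ IStarNI n t Δ ≤ C * t * Δ ^ 2 / n) := by
  rintro ε ⟨hε, -⟩
  have hC : 0 < 32 / ε ^ 2 + 4 := by positivity
  have hC' : 0 < 2 / ε := by positivity
  refine ⟨1 / 128, 32 / ε ^ 2 + 4 + 2 / ε, by norm_num, by positivity, ?_⟩
  rintro n hn Δ ⟨h0, h1⟩ t ht htn
  have hnpos : 0 < n := by omega
  have hlog : 0 ≤ Real.log (1 + t * Δ ^ 2) :=
    Real.log_nonneg (le_add_of_nonneg_right (by positivity))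
  refine ⟨⟨le_pStarNI hε hn h0 h1 ht htn, ?_⟩, le_IStarNI hε hn h0 h1 htn, ?_⟩
  · refine csSup_le ⟨_, _, _, isNIPulls_purePulls fun _ => ⟨0, hnpos⟩,
      isNIOut_ite fun _ _ => ⟨0, hnpos⟩, rfl⟩ ?_
    rintro _ ⟨ν, out, hν, hout, rfl⟩
    refine (niSuccProb_le hε h0 h1 ht hν hout).trans ?_
    gcongr ?_ * _ * _ / _
    linarith
  · refine csSup_le ⟨_, _, isNIPulls_purePulls fun _ => ⟨0, hnpos⟩, rfl⟩ ?_
    rintro _ ⟨ν, hν, rfl⟩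
    refine (niMutualInfo_le hε h0 h1 hnpos hν).trans ?_
    gcongr
    linarith
end
end

section
/- For every integer k ≥ 1 and every integer ℓ with (k − √k)/2 ≤ ℓ ≤ (k + √k)/2, the binomial coefficient satisfies C(k, ℓ) ≥ 2^k/(4√k). -/
theorem sixteen_pow_le_four_mul_mul_centralBinom_sq (n : ℕ) (hn : 1 ≤ n) :
    16 ^ n ≤ 4 * n * n.centralBinom ^ 2 := by
  induction n, hn using Nat.le_induction with
  | base => simp [Nat.centralBinom]
  | succ n hn ih =>
    have h := Nat.succ_mul_centralBinom_succ n
    have key : (n + 1) * 16 ^ (n + 1) ≤ (n + 1) * (4 * (n + 1) * (n + 1).centralBinom ^ 2) :=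
      calc (n + 1) * 16 ^ (n + 1) = 16 * (n + 1) * 16 ^ n := by ring
        _ ≤ 16 * (n + 1) * (4 * n * n.centralBinom ^ 2) := by gcongr
        _ = 16 * (4 * n * (n + 1)) * n.centralBinom ^ 2 := by ring
        _ ≤ 16 * (2 * n + 1) ^ 2 * n.centralBinom ^ 2 := by gcongr; nlinarith
        _ = 4 * (2 * (2 * n + 1) * n.centralBinom) ^ 2 := by ring
        _ = (n + 1) * (4 * (n + 1) * (n + 1).centralBinom ^ 2) := by rw [← h]; ring
    exact Nat.le_of_mul_le_mul_left key n.succ_pos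

/-- Moving `d` steps away from the middle costs a binomial coefficient at most a factor
`1 - d * (d + m - p) / m`. -/
theorem choose_mul_sub_le_choose_add_mul (m p d : ℕ) (hpm : p ≤ m) :
    ((m + p).choose m : ℝ) * (m - d * (d + m - p)) ≤ (m + p).choose (m + d) * m := by
  have hpm' : (p : ℝ) ≤ m := mod_cast hpm
  induction d with
  | zero => simp
  | succ d ih =>
    have hA : (0 : ℝ) ≤ (m + p).choose m := Nat.cast_nonneg _
    have hd : (0 : ℝ) ≤ d := Nat.cast_nonneg _
    rcases le_or_gt d p with hdp | hdp
    · have hdp' : (d : ℝ) ≤ p := mod_cast hdp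
      have h : ((m + p).choose (m + (d + 1)) : ℝ) * (m + d + 1) =
          (m + p).choose (m + d) * (p - d) := by
        have := Nat.choose_succ_right_eq (m + p) (m + d)
        rw [Nat.add_sub_add_left] at this
        rw [← Nat.cast_sub hdp]
        exact_mod_cast this
      have ht : (0 : ℝ) ≤ (2 * d + 1 + m - p) * (d + 1 + d * (d + m - p)) :=
        mul_nonneg (by linarith)
          (add_nonneg (by linarith) (mul_nonneg hd (by linarith)))
      have hpos : (0 : ℝ) < m + d + 1 := by positivity
      refine le_of_mul_le_mul_right ?_ hpos
      have h1 := mul_le_mul_of_nonneg_right ih (sub_nonneg.2 hdp')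
      have h2 := mul_nonneg hA ht
      push_cast
      linear_combination h1 + h2 - m * h
    · have hdp' : (p : ℝ) ≤ d := mod_cast hdp.le
      refine le_trans (mul_nonpos_of_nonneg_of_nonpos hA ?_) (by positivity)
      push_cast
      nlinarith [mul_nonneg hd (show (0 : ℝ) ≤ d + 1 + m - p by linarith)]

theorem choose_le_two_mul_choose_add (m p d : ℕ) (hm : 1 ≤ m) (hpm : p ≤ m)
    (h : 2 * ((d : ℝ) * (d + m - p)) ≤ m) :
    (m + p).choose m ≤ 2 * (m + p).choose (m + d) := by
  have hm' : (0 : ℝ) < m := mod_cast hm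
  have h1 := choose_mul_sub_le_choose_add_mul m p d hpm
  have h2 : ((m + p).choose m : ℝ) * (m / 2) ≤ (m + p).choose m * (m - d * (d + m - p)) := by
    gcongr
    linarith
  have h3 : ((m + p).choose m : ℝ) ≤ 2 * (m + p).choose (m + d) := by
    refine le_of_mul_le_mul_right ?_ hm'
    linarith
  exact_mod_cast h3

theorem four_pow_le_sixteen_mul_mul_choose_sq (k l : ℕ) (hk : 1 ≤ k) (hkl : k ≤ 2 * l)
    (h : (2 * (l : ℝ) - k) ^ 2 ≤ k) : 4 ^ k ≤ 16 * k * k.choose l ^ 2 := by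
  obtain ⟨n, rfl | rfl⟩ := Nat.even_or_odd' k
  · obtain ⟨d, rfl⟩ := Nat.exists_eq_add_of_le (show n ≤ l by omega)
    push_cast at h
    have hc := choose_le_two_mul_choose_add n n d (by omega) le_rfl (by nlinarith)
    rw [← two_mul, ← Nat.centralBinom_eq_two_mul_choose] at hc
    calc 4 ^ (2 * n) = 16 ^ n := by rw [pow_mul]; norm_num
      _ ≤ 4 * n * n.centralBinom ^ 2 :=
        sixteen_pow_le_four_mul_mul_centralBinom_sq n (by omega)
      _ ≤ 4 * n * (2 * (2 * n).choose (n + d)) ^ 2 := by gcongr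
      _ = 16 * n * (2 * n).choose (n + d) ^ 2 := by ring
      _ ≤ 16 * (2 * n) * (2 * n).choose (n + d) ^ 2 := by gcongr; omega
  · obtain ⟨d, rfl⟩ := Nat.exists_eq_add_of_le (show n + 1 ≤ l by omega)
    push_cast at h
    have hc := choose_le_two_mul_choose_add (n + 1) n d (by omega) (by omega)
      (by push_cast; nlinarith)
    rw [show n + 1 + n = 2 * n + 1 by ring] at hc
    have hcb : (n + 1).centralBinom = 2 * (2 * n + 1).choose (n + 1) := by
      rw [Nat.centralBinom_eq_two_mul_choose, show 2 * (n + 1) = 2 * n + 1 + 1 by ring,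
        Nat.choose_succ_succ, Nat.choose_symm_half]
      ring
    have key : 4 * 4 ^ (2 * n + 1) ≤ 4 * (16 * (2 * n + 1) * (2 * n + 1).choose (n + 1 + d) ^ 2) :=
      calc 4 * 4 ^ (2 * n + 1) = 16 ^ (n + 1) := by
            rw [show (16 : ℕ) = 4 ^ 2 by norm_num, ← pow_mul]; ring
        _ ≤ 4 * (n + 1) * (n + 1).centralBinom ^ 2 :=
          sixteen_pow_le_four_mul_mul_centralBinom_sq (n + 1) (by omega)
        _ ≤ 4 * (2 * n + 1) * (2 * (2 * (2 * n + 1).choose (n + 1 + d))) ^ 2 := by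
          rw [hcb]; gcongr; omega
        _ = 4 * (16 * (2 * n + 1) * (2 * n + 1).choose (n + 1 + d) ^ 2) := by ring
    exact Nat.le_of_mul_le_mul_left key (by norm_num)

/-- Central binomial coefficient bound: for every integer `k ≥ 1` and every integer `ℓ` with
`(k - √k)/2 ≤ ℓ ≤ (k + √k)/2`, we have `C(k, ℓ) ≥ 2^k / (4 √k)`. -/
theorem central_binomial_coefficient_bound
    (k : ℕ) (hk : 1 ≤ k) (ℓ : ℕ)
    (hl : ((k : ℝ) - Real.sqrt k) / 2 ≤ (ℓ : ℝ))
    (hu : (ℓ : ℝ) ≤ ((k : ℝ) + Real.sqrt k) / 2) :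
    (2 : ℝ) ^ k / (4 * Real.sqrt k) ≤ (k.choose ℓ : ℝ) := by
  have hk' : (1 : ℝ) ≤ k := mod_cast hk
  have hs : Real.sqrt k ^ 2 = k := Real.sq_sqrt (by linarith)
  have hs0 : 0 < Real.sqrt k := Real.sqrt_pos.2 (by linarith)
  have hsq : (2 * (ℓ : ℝ) - k) ^ 2 ≤ k := by
    rw [← hs]
    refine sq_le_sq' ?_ ?_ <;> rw [hs] <;> linarith
  have hlk : ℓ ≤ k := by
    have : (ℓ : ℝ) ≤ k := by nlinarith
    exact_mod_cast this
  have main : 4 ^ k ≤ 16 * k * k.choose ℓ ^ 2 := by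
    rcases le_total k (2 * ℓ) with h | h
    · exact four_pow_le_sixteen_mul_mul_choose_sq k ℓ hk h hsq
    · rw [← Nat.choose_symm hlk]
      refine four_pow_le_sixteen_mul_mul_choose_sq k (k - ℓ) hk (by omega) ?_
      rw [Nat.cast_sub hlk]
      linarith
  have main' : (4 : ℝ) ^ k ≤ 16 * k * (k.choose ℓ : ℝ) ^ 2 := mod_cast main
  rw [div_le_iff₀ (by positivity)]
  refine le_of_sq_le_sq ?_ (by positivity)
  calc ((2 : ℝ) ^ k) ^ 2 = 4 ^ k := by rw [← pow_mul, mul_comm, pow_mul]; norm_num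
    _ ≤ 16 * k * (k.choose ℓ : ℝ) ^ 2 := main'
    _ = (k.choose ℓ * (4 * Real.sqrt k)) ^ 2 := by rw [mul_pow, mul_pow, hs]; ring
end

section
/- For every ε ∈ (0,1) there exists a constant c > 0 such that for all Δ ∈ (0, 1-ε] and all integers k ≥ 1 with kΔ² ≤ 1, the total variation distance between the binomial distributions Bin(k, (1−Δ)/2) and Bin(k, (1+Δ)/2) is at least c·√(kΔ²). -/
/-- The probability mass function of the binomial distribution `Bin(k, p)` at `j`. -/
noncomputable def binPMF (k : ℕ) (p : ℝ) (j : ℕ) : ℝ :=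
  (k.choose j : ℝ) * p ^ j * (1 - p) ^ (k - j)

/-- The characteristic function of a symmetrised binomial variable: `2 X - k` for
`X ∼ Bin(k, p)`. -/
lemma sum_binPMF_mul_exp (k : ℕ) (p θ : ℝ) :
    ∑ j ∈ Finset.range (k + 1), (binPMF k p j : ℂ) *
        (Complex.exp (θ * Complex.I) ^ j * Complex.exp ((-θ : ℝ) * Complex.I) ^ (k - j)) =
      (p * Complex.exp (θ * Complex.I) + (1 - p) * Complex.exp ((-θ : ℝ) * Complex.I)) ^ k := by
  rw [add_pow]
  refine Finset.sum_congr rfl fun j _ => ?_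
  simp only [binPMF, mul_pow]
  push_cast
  ring

/-- The total mass of the difference of two binomial distributions dominates the difference of
their characteristic functions. -/
lemma norm_charFun_sub_le_sum_abs (k : ℕ) (p q θ : ℝ) :
    ‖(p * Complex.exp (θ * Complex.I) + (1 - p) * Complex.exp ((-θ : ℝ) * Complex.I)) ^ k -
      (q * Complex.exp (θ * Complex.I) + (1 - q) * Complex.exp ((-θ : ℝ) * Complex.I)) ^ k‖ ≤
      ∑ j ∈ Finset.range (k + 1), |binPMF k p j - binPMF k q j| := by
  rw [← sum_binPMF_mul_exp, ← sum_binPMF_mul_exp, ← Finset.sum_sub_distrib]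
  refine (norm_sum_le _ _).trans (Finset.sum_le_sum fun j _ => ?_)
  rw [← sub_mul, norm_mul, norm_mul, norm_pow, norm_pow, Complex.norm_exp_ofReal_mul_I,
    Complex.norm_exp_ofReal_mul_I, ← Complex.ofReal_sub, Complex.norm_real, Real.norm_eq_abs]
  simp

/-- A lower bound for the imaginary part of a power of a complex number close to the positive
real axis. -/
lemma le_im_pow {z : ℂ} {k : ℕ} (hre : 0 < z.re) (him : 0 ≤ z.im) (hz : ‖z‖ ≤ 1)
    (hk : k * z.im ≤ z.re) : z.re ^ k * (2 / Real.pi * (k * z.im)) ≤ (z ^ k).im := by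
  have hpi := Real.pi_pos
  have hrn : z.re ≤ ‖z‖ := Complex.re_le_norm z
  have hn : 0 < ‖z‖ := hre.trans_le hrn
  have h0 : 0 ≤ z.arg := Complex.arg_nonneg_iff.2 him
  have h1 : z.arg ≤ Real.pi / 2 := Complex.arg_le_pi_div_two_iff.2 (Or.inl hre.le)
  have hsin : ‖z‖ * Real.sin z.arg = z.im := Complex.norm_mul_sin_arg z
  have hlower : z.im ≤ z.arg := by
    have := Real.sin_le h0
    nlinarith
  have hupper : 2 / Real.pi * z.arg * z.re ≤ z.im := by
    have := Real.mul_le_sin h0 h1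
    have h2 : 0 ≤ 2 / Real.pi * z.arg := by positivity
    nlinarith
  have hangle : (k : ℝ) * z.arg ≤ Real.pi / 2 := by
    have h2 : 2 / Real.pi * ((k : ℝ) * z.arg) * z.re ≤ 1 * z.re := by
      have := mul_le_mul_of_nonneg_left hupper (Nat.cast_nonneg (α := ℝ) k)
      linarith
    have h3 := le_of_mul_le_mul_right h2 hre
    rw [div_mul_eq_mul_div, div_le_iff₀ hpi] at h3
    linarith
  have hpow : (z ^ k).im = ‖z‖ ^ k * Real.sin (k * z.arg) := by
    conv_lhs => rw [← Complex.norm_mul_exp_arg_mul_I z, mul_pow, ← Complex.exp_nat_mul,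
      ← Complex.ofReal_pow, Complex.im_ofReal_mul]
    rw [← Complex.exp_ofReal_mul_I_im]
    push_cast
    ring_nf
  rw [hpow]
  have hs := Real.mul_le_sin (x := (k : ℝ) * z.arg) (by positivity) hangle
  gcongr
  exact le_trans (by gcongr) hs

/-- Total variation lower bound for binomials: for every `ε ∈ (0,1)` there is `c > 0` such
that for all `Δ ∈ (0, 1-ε]` and all integers `k ≥ 1` with `kΔ² ≤ 1`,
`TV(Bin(k, (1-Δ)/2), Bin(k, (1+Δ)/2)) ≥ c √(kΔ²)`. -/
theorem binomial_tv_lower_bound :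
    ∀ ε : ℝ, ε ∈ Set.Ioo (0 : ℝ) 1 → ∃ c : ℝ, 0 < c ∧
      ∀ Δ : ℝ, Δ ∈ Set.Ioc (0 : ℝ) (1 - ε) →
        ∀ k : ℕ, 1 ≤ k → (k : ℝ) * Δ ^ 2 ≤ 1 →
          c * Real.sqrt ((k : ℝ) * Δ ^ 2) ≤
            (1 / 2) * ∑ j ∈ Finset.range (k + 1),
              |binPMF k ((1 - Δ) / 2) j - binPMF k ((1 + Δ) / 2) j| := by
  intro ε _
  refine ⟨7 / 64, by norm_num, fun Δ hΔ k hk hkΔ => ?_⟩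
  have hΔ0 : 0 < Δ := hΔ.1
  have hk1 : (1 : ℝ) ≤ k := by exact_mod_cast hk
  obtain ⟨s, hs, hsk⟩ : ∃ s : ℝ, 0 < s ∧ s ^ 2 = k :=
    ⟨√k, Real.sqrt_pos.2 (by linarith), Real.sq_sqrt (by linarith)⟩
  have hs1 : 1 ≤ s := by nlinarith
  have hsqrt : √((k : ℝ) * Δ ^ 2) = s * Δ := by
    rw [← hsk, ← mul_pow, Real.sqrt_sq (by positivity)]
  have hsΔ : s * Δ ≤ 1 := by
    rw [← hsk, ← mul_pow] at hkΔ
    nlinarith [mul_pos hs hΔ0]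
  have hΔ1 : Δ ≤ 1 := by nlinarith
  set θ : ℝ := 1 / (2 * s) with hθ
  have hθ0 : 0 < θ := by positivity
  have hsθ : s * θ = 1 / 2 := by rw [hθ]; field_simp
  have hθ1 : θ ≤ 1 / 2 := by nlinarith
  have hpi : (1 : ℝ) / 2 ≤ 2 / Real.pi := by
    rw [div_le_div_iff₀ two_pos Real.pi_pos]
    linarith [Real.pi_le_four]
  have hsin : θ / 2 ≤ Real.sin θ := by
    have := Real.mul_le_sin hθ0.le (by linarith [Real.pi_gt_three])
    nlinarith
  have hsin' : Real.sin θ ≤ θ := Real.sin_le hθ0.le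
  have hcos : 1 - θ ^ 2 / 2 ≤ Real.cos θ := Real.one_sub_sq_div_two_le_cos
  have hcosk : (7 : ℝ) / 8 ≤ Real.cos θ ^ k := by
    have hb := one_add_mul_le_pow (a := -(θ ^ 2 / 2)) (by nlinarith) k
    have hkθ : (k : ℝ) * θ ^ 2 = 1 / 4 := by rw [← hsk, ← mul_pow, hsθ]; norm_num
    have hc : (1 + -(θ ^ 2 / 2)) ^ k ≤ Real.cos θ ^ k :=
      pow_le_pow_left₀ (by nlinarith) (by linarith) k
    linarith
  set z : ℂ := ⟨Real.cos θ, Δ * Real.sin θ⟩ with hz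
  have hznorm : ‖z‖ ≤ 1 := by
    rw [← sq_le_one_iff₀ (norm_nonneg z), ← Complex.normSq_eq_norm_sq, Complex.normSq_apply]
    have hΔ2 : Δ ^ 2 ≤ 1 := by nlinarith
    simp only [hz]
    nlinarith [Real.sin_sq_add_cos_sq θ,
      mul_le_mul_of_nonneg_right hΔ2 (sq_nonneg (Real.sin θ))]
  have hkim : (k : ℝ) * (Δ * Real.sin θ) ≤ Real.cos θ := by
    have : (k : ℝ) * (Δ * Real.sin θ) ≤ k * (Δ * θ) := by gcongr
    have h2 : (k : ℝ) * (Δ * θ) = s * Δ * (s * θ) := by rw [← hsk]; ring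
    nlinarith
  have him : Real.cos θ ^ k * (2 / Real.pi * (k * (Δ * Real.sin θ))) ≤ (z ^ k).im :=
    le_im_pow (z := z) (k := k) (show 0 < Real.cos θ by nlinarith)
    (show 0 ≤ Δ * Real.sin θ from mul_nonneg hΔ0.le (by linarith)) hznorm hkim
  have hmain : 7 / 64 * (s * Δ) ≤ (z ^ k).im := by
    refine le_trans ?_ him
    calc 7 / 64 * (s * Δ) = 7 / 8 * (1 / 2 * (k * (Δ * (θ / 2)))) := by
          rw [← hsk]; linear_combination (-7 / 32 * (s * Δ)) * hsθ
      _ ≤ _ := by gcongr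
  have hplus : (((1 + Δ) / 2 : ℝ) : ℂ) * Complex.exp (θ * Complex.I) +
      (1 - ((1 + Δ) / 2 : ℝ)) * Complex.exp ((-θ : ℝ) * Complex.I) = z := by
    apply Complex.ext <;>
      simp [Complex.exp_ofReal_mul_I_re, Complex.exp_ofReal_mul_I_im, hz, -Complex.ofReal_neg,
        -Complex.ofReal_div, -Complex.ofReal_add] <;> ring
  have hminus : (((1 - Δ) / 2 : ℝ) : ℂ) * Complex.exp (θ * Complex.I) +
      (1 - ((1 - Δ) / 2 : ℝ)) * Complex.exp ((-θ : ℝ) * Complex.I) = starRingEnd ℂ z := by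
    apply Complex.ext <;>
      simp [Complex.exp_ofReal_mul_I_re, Complex.exp_ofReal_mul_I_im, hz, -Complex.ofReal_neg,
        -Complex.ofReal_div, -Complex.ofReal_sub] <;> ring
  have hsum := norm_charFun_sub_le_sum_abs k ((1 - Δ) / 2) ((1 + Δ) / 2) θ
  rw [hplus, hminus, ← map_pow] at hsum
  have hge := (neg_le_abs _).trans (Complex.abs_im_le_norm (starRingEnd ℂ (z ^ k) - z ^ k))
  rw [Complex.sub_im, Complex.conj_im] at hge
  rw [hsqrt]
  linarith
end
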